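/- Let X be a compact Hausdorff space and A a unital C*-algebra, and let C(X, A) be the unital C*-algebra of continuous A-valued functions on X with pointwise operations and supremum norm. Then every state ω on C(X, A) lies in the weak-* closure of the convex hull of the set of functionals of the form f ↦ ρ(f(x)), where x ranges over X and ρ ranges over the states of A. Equivalently, ω is the weak-* limit of a net of finite convex combinations ∑_{i=1}^{k} λ_i · (f ↦ ρ_i(f(x_i))) with λ_i ≥ 0, ∑_i λ_i = 1, x_i ∈ X, and each ρ_i a state on A. -/

import Mathlib

open ComplexOrder

/-- A state on a unital C*-algebra `A`: a linear functional `ω : A → ℂ` with `ω 1 = 1` and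
`ω (star a * a) ≥ 0` (a nonnegative real, in the partial order on `ℂ`) for every `a`. -/
def IsState (A : Type*) [CStarAlgebra A] (ω : A →ₗ[ℂ] ℂ) : Prop :=
  ω 1 = 1 ∧ ∀ a : A, 0 ≤ ω (star a * a)

/-- A linear functional that is nonnegative on all `star a * a` is bounded by a multiple of its
value at `1`. -/
lemma norm_apply_le_of_star_mul_self_nonneg {A : Type*} [CStarAlgebra A] (φ : A →ₗ[ℂ] ℂ)
    (hφ : ∀ a, 0 ≤ φ (star a * a)) (a : A) : ‖φ a‖ ≤ 4 * ‖φ 1‖ * ‖a‖ := by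
  let _ := CStarAlgebra.spectralOrder A
  let _ := CStarAlgebra.spectralOrderedRing A
  let ψ : A →ₚ[ℂ] ℂ := PositiveLinearMap.mk₀ φ fun x hx ↦ by
    obtain ⟨b, rfl⟩ := CStarAlgebra.nonneg_iff_eq_star_mul_self.mp hx
    exact hφ b
  obtain ⟨y, hy_nonneg, hy_norm, hy⟩ := CStarAlgebra.exists_sum_four_nonneg a
  calc ‖φ a‖ = ‖∑ i : Fin 4, Complex.I ^ (i : ℕ) • φ (y i)‖ := by
        conv_lhs => rw [hy]
        simp only [map_sum, map_smul]
    _ ≤ ∑ _i : Fin 4, ‖φ 1‖ * ‖a‖ := by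
        refine norm_sum_le_of_le _ fun i _ ↦ ?_
        rw [norm_smul, norm_pow, Complex.norm_I, one_pow, one_mul]
        exact (ψ.norm_apply_le_of_nonneg (y i) (hy_nonneg i)).trans
          (mul_le_mul_of_nonneg_left (hy_norm i) (norm_nonneg _))
    _ = 4 * ‖φ 1‖ * ‖a‖ := by simp [mul_assoc]

/-- The map `a ↦ χ · a` from `A` to `C(X, A)`, for a real-valued function `χ`. -/
def ContinuousMap.smulConst {X : Type*} [TopologicalSpace X] {A : Type*} [CStarAlgebra A]
    (χ : C(X, ℝ)) : A →ₗ[ℂ] C(X, A) where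
  toFun a := ⟨fun x ↦ (χ x : ℂ) • a, by fun_prop⟩
  map_add' a b := by ext; simp
  map_smul' c a := by ext; simp [smul_comm c]

lemma ContinuousMap.smulConst_apply {X : Type*} [TopologicalSpace X] {A : Type*} [CStarAlgebra A]
    (χ : C(X, ℝ)) (a : A) (x : X) : χ.smulConst a x = (χ x : ℂ) • a := rfl

lemma ContinuousMap.smulConst_star_mul_self {X : Type*} [TopologicalSpace X] {A : Type*}
    [CStarAlgebra A] {χ : C(X, ℝ)} (hχ : 0 ≤ χ) (a : A) :
    ∃ b : C(X, A), χ.smulConst (star a * a) = star b * b := by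
  refine ⟨smulConst ⟨fun x ↦ √(χ x), by fun_prop⟩ a, ?_⟩
  ext x
  simp only [smulConst_apply, mul_apply, star_apply, star_smul, coe_mk, smul_mul_smul_comm]
  congr 1
  rw [Complex.star_def, Complex.conj_ofReal, ← Complex.ofReal_mul]
  exact congrArg _ (Real.mul_self_sqrt (hχ x)).symm

/-- A positive functional on `A` is a nonnegative multiple of a state, provided `A` has a state. -/
lemma exists_isState_eq_smul {A : Type*} [CStarAlgebra A] {ρ₀ : A →ₗ[ℂ] ℂ} (hρ₀ : IsState A ρ₀)
    (φ : A →ₗ[ℂ] ℂ) (hφ : ∀ a, 0 ≤ φ (star a * a)) :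
    ∃ (l : ℝ) (ρ : A →ₗ[ℂ] ℂ), 0 ≤ l ∧ IsState A ρ ∧ φ = (l : ℂ) • ρ := by
  have h1 : 0 ≤ φ 1 := by simpa using hφ 1
  obtain ⟨l, hl⟩ : ∃ l : ℝ, φ 1 = l := ⟨(φ 1).re, Complex.eq_re_of_ofReal_le h1⟩
  have hl0 : 0 ≤ l := by rw [hl] at h1; exact_mod_cast h1
  rcases hl0.eq_or_lt with rfl | hpos
  · refine ⟨0, ρ₀, le_rfl, hρ₀, LinearMap.ext fun a ↦ ?_⟩
    simpa [hl] using norm_apply_le_of_star_mul_self_nonneg φ hφ a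
  · have hne : (l : ℂ) ≠ 0 := by exact_mod_cast hpos.ne'
    refine ⟨l, (l : ℂ)⁻¹ • φ, hl0, ⟨by simp [hl, hne], fun a ↦ ?_⟩, by simp [smul_smul, hne]⟩
    rw [LinearMap.smul_apply, smul_eq_mul, ← Complex.ofReal_inv]
    exact mul_nonneg (by exact_mod_cast inv_nonneg.mpr hl0) (hφ a)

/-- Finitely many functions in `C(X, A)` are simultaneously approximated by
`∑ i, χ i · f (x i)` for a single partition of unity `χ` and sample points `x`. -/
lemma exists_partitionOfUnity_norm_sub_le {X : Type*} [TopologicalSpace X] [CompactSpace X]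
    [T2Space X] {A : Type*} [CStarAlgebra A] (I : Set C(X, A)) (hI : I.Finite) {ε : ℝ}
    (hε : 0 < ε) :
    ∃ (k : ℕ) (x : Fin k → X) (χ : Fin k → C(X, ℝ)), (∀ i, 0 ≤ χ i) ∧ (∀ y, ∑ i, χ i y = 1) ∧
      ∀ f ∈ I, ‖f - ∑ i, (χ i).smulConst (f (x i))‖ ≤ ε := by
  let U (x : X) : Set X := ⋂ f ∈ I, {y | ‖f y - f x‖ < ε}
  have hUo (x : X) : IsOpen (U x) :=
    hI.isOpen_biInter fun f _ ↦ isOpen_lt (by fun_prop) continuous_const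
  have hUx (x : X) : x ∈ U x := by simp [U, hε]
  obtain ⟨t, ht⟩ := isCompact_univ.elim_finite_subcover U hUo
    fun x _ ↦ Set.mem_iUnion.mpr ⟨x, hUx x⟩
  let x (i : Fin t.card) : X := (t.equivFin.symm i : X)
  have hcover : Set.univ ⊆ ⋃ i, U (x i) := fun y hy ↦ by
    obtain ⟨z, hz, hyz⟩ := Set.mem_iUnion₂.mp (ht hy)
    exact Set.mem_iUnion.mpr ⟨t.equivFin ⟨z, hz⟩, by simpa [x] using hyz⟩
  obtain ⟨χ, hχ⟩ := PartitionOfUnity.exists_isSubordinate isClosed_univ (fun i ↦ U (x i))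
    (fun i ↦ hUo _) hcover
  have hsum (y : X) : ∑ i, χ i y = 1 := by
    rw [← finsum_eq_sum_of_fintype]
    exact χ.sum_eq_one (Set.mem_univ y)
  refine ⟨t.card, x, χ, fun i y ↦ χ.nonneg i y, hsum, fun f hf ↦ ?_⟩
  refine (ContinuousMap.norm_le _ hε.le).mpr fun y ↦ ?_
  have hfy : f y = ∑ i, (χ i y : ℂ) • f y := by
    rw [← Finset.sum_smul, ← Complex.ofReal_sum, hsum, Complex.ofReal_one, one_smul]
  rw [ContinuousMap.sub_apply, ContinuousMap.sum_apply, hfy, ← Finset.sum_sub_distrib]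
  calc ‖∑ i, ((χ i y : ℂ) • f y - (χ i).smulConst (f (x i)) y)‖ ≤ ∑ i, χ i y * ε := by
        refine norm_sum_le_of_le _ fun i _ ↦ ?_
        rw [ContinuousMap.smulConst_apply, ← smul_sub, norm_smul, Complex.norm_real,
          Real.norm_of_nonneg (χ.nonneg i y)]
        by_cases h0 : χ i y = 0
        · simp [h0]
        · have hy : y ∈ U (x i) := hχ i (subset_tsupport _ h0)
          exact mul_le_mul_of_nonneg_left (Set.mem_iInter₂.mp hy f hf).le (χ.nonneg i y)
    _ = ε := by rw [← Finset.sum_mul, hsum, one_mul]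

/-- Every state on `C(X, A)` (`X` compact Hausdorff, `A` a unital C*-algebra, so
`C(X, A) ≅ C(X, ℂ) ⊗ A`) is separable: it lies in the weak-* closure (the closure for the
topology of pointwise convergence of functionals, i.e. the product topology on
`C(X, A) → ℂ`) of the convex hull of the functionals `f ↦ ρ (f x)` with `x ∈ X` and `ρ` a
state on `A`; equivalently, it is a weak-* limit of finite convex combinations
`∑ i, λ i • (f ↦ ρ i (f (x i)))`. -/
theorem state_on_continuous_functions_is_separable
    {X : Type*} [TopologicalSpace X] [CompactSpace X] [T2Space X]
    {A : Type*} [CStarAlgebra A]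
    (ω : C(X, A) →ₗ[ℂ] ℂ) (hω : IsState C(X, A) ω) :
    ⇑ω ∈ closure {g : C(X, A) → ℂ |
      ∃ (k : ℕ) (l : Fin k → ℝ) (x : Fin k → X) (ρ : Fin k → (A →ₗ[ℂ] ℂ)),
        (∀ i, 0 ≤ l i) ∧ (∑ i, l i = 1) ∧ (∀ i, IsState A (ρ i)) ∧
        g = fun f => ∑ i, (l i : ℂ) * ρ i (f (x i))} := by
  have hpos {χ : C(X, ℝ)} (hχ : 0 ≤ χ) (a : A) :
      0 ≤ (ω ∘ₗ χ.smulConst) (star a * a) := by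
    obtain ⟨b, hb⟩ := ContinuousMap.smulConst_star_mul_self hχ a
    rw [LinearMap.comp_apply, hb]
    exact hω.2 b
  have hone : (1 : C(X, ℝ)).smulConst (1 : A) = 1 := by
    ext; simp [ContinuousMap.smulConst_apply]
  have hρ₀ : IsState A (ω ∘ₗ (1 : C(X, ℝ)).smulConst) :=
    ⟨by rw [LinearMap.comp_apply, hone, hω.1], hpos zero_le_one⟩
  rw [mem_closure_iff_nhds]
  intro V hV
  rw [nhds_pi, (Filter.hasBasis_pi fun f ↦ Metric.nhds_basis_ball (x := ω f)).mem_iff] at hV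
  obtain ⟨⟨I, r⟩, ⟨hI, hr⟩, hV⟩ := hV
  obtain ⟨δ, hδ, hδr⟩ : ∃ δ > 0, ∀ f ∈ I, δ < r f := by
    have : ∀ᶠ δ in nhdsWithin (0 : ℝ) (Set.Ioi 0), ∀ f ∈ I, δ < r f :=
      (Filter.eventually_all_finite hI).mpr fun f hf ↦
        nhdsWithin_le_nhds (eventually_lt_nhds (hr f hf))
    obtain ⟨δ, h, hδ⟩ := (this.and self_mem_nhdsWithin).exists
    exact ⟨δ, hδ, h⟩
  obtain ⟨k, x, χ, hχ, hsum, hnorm⟩ :=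
    exists_partitionOfUnity_norm_sub_le I hI (div_pos hδ four_pos)
  choose l ρ hl hρ hlρ using fun i ↦
    exists_isState_eq_smul hρ₀ (ω ∘ₗ (χ i).smulConst) (hpos (hχ i))
  have happly (i : Fin k) (a : A) : ω ((χ i).smulConst a) = l i * ρ i a :=
    DFunLike.congr_fun (hlρ i) a
  have hl1 : ∑ i, l i = 1 := by
    have hsum1 : ∑ i, (χ i).smulConst (1 : A) = 1 := by
      ext y
      simp [ContinuousMap.smulConst_apply, ← Finset.sum_smul, hsum]
    have h := hω.1
    rw [← hsum1, map_sum] at h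
    simp only [happly, (hρ _).1, mul_one] at h
    exact_mod_cast h
  refine ⟨fun f ↦ ∑ i, (l i : ℂ) * ρ i (f (x i)), hV fun f hf ↦ ?_,
    k, l, x, ρ, hl, hl1, hρ, rfl⟩
  rw [Metric.mem_ball, dist_comm, dist_eq_norm]
  refine lt_of_le_of_lt ?_ (hδr f hf)
  calc ‖ω f - ∑ i, (l i : ℂ) * ρ i (f (x i))‖
      = ‖ω (f - ∑ i, (χ i).smulConst (f (x i)))‖ := by simp only [map_sub, map_sum, happly]
    _ ≤ 4 * ‖ω 1‖ * ‖f - ∑ i, (χ i).smulConst (f (x i))‖ :=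
        norm_apply_le_of_star_mul_self_nonneg ω hω.2 _
    _ ≤ 4 * (δ / 4) := by
        rw [hω.1, norm_one, mul_one]
        exact mul_le_mul_of_nonneg_left (hnorm f hf) (by norm_num)
    _ = δ := by ring
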